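/- sup_{t ∈ [0, T]} |X^ε_t − X̄_t| → 0 as ε → 0⁺ (the pathwise averaging principle). -/

import Mathlib

open intervalIntegral

/-- `Y : ℝ → ℝ` is a continuous solution on `[0, T]` of the (Doss–Sussmann transformed)
integral equation
`Y t = H (0, x₀) + ∫₀^t (∂H/∂x) (m s, F (m s, Y s)) · b (F (m s, Y s), s / ε) ds`. -/
def SolvesAveragingODE (F H : ℝ × ℝ → ℝ) (b : ℝ × ℝ → ℝ) (m : ℝ → ℝ)
    (T x₀ ε : ℝ) (Y : ℝ → ℝ) : Prop :=
  ContinuousOn Y (Set.Icc 0 T) ∧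
  ∀ t ∈ Set.Icc (0:ℝ) T,
    Y t = H (0, x₀) + ∫ s in (0:ℝ)..t,
      deriv (fun y : ℝ => H (m s, y)) (F (m s, Y s)) * b (F (m s, Y s), s / ε)

/-! The flow `F` of a Lipschitz vector field `σ` on the line: dependence on the initial point. -/

/-- The average of `σ'` over the segment from `x` to `y`. -/
noncomputable def derivAverage (σ : ℝ → ℝ) (x y : ℝ) : ℝ :=
  ∫ θ in (0:ℝ)..1, deriv σ (x + θ * (y - x))

theorem derivAverage_self (σ : ℝ → ℝ) (x : ℝ) : derivAverage σ x x = deriv σ x := by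
  simp [derivAverage]

theorem continuous_derivAverage {σ : ℝ → ℝ} (hσ : Continuous (deriv σ)) :
    Continuous fun p : ℝ × ℝ => derivAverage σ p.1 p.2 := by
  unfold derivAverage
  apply intervalIntegral.continuous_parametric_intervalIntegral_of_continuous'
  fun_prop

theorem abs_derivAverage_le {σ : ℝ → ℝ} {C : ℝ} (hC : ∀ x, |deriv σ x| ≤ C) (x y : ℝ) :
    |derivAverage σ x y| ≤ C := by
  have := intervalIntegral.norm_integral_le_of_norm_le_const (a := (0:ℝ)) (b := 1) (C := C)
    (f := fun θ => deriv σ (x + θ * (y - x))) (fun θ _ => hC _)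
  simpa [derivAverage] using this

theorem derivAverage_mul_sub {σ : ℝ → ℝ} (hσ : ContDiff ℝ 1 σ) (x y : ℝ) :
    derivAverage σ x y * (y - x) = σ y - σ x := by
  have hd : Continuous (deriv σ) := hσ.continuous_deriv le_rfl
  have h : ∀ θ ∈ Set.uIcc (0:ℝ) 1, HasDerivAt (fun θ : ℝ => σ (x + θ * (y - x)))
      (deriv σ (x + θ * (y - x)) * (y - x)) θ := by
    intro θ _
    have h1 : HasDerivAt (fun θ : ℝ => x + θ * (y - x)) (y - x) θ := by
      simpa using ((hasDerivAt_id θ).mul_const (y - x)).const_add x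
    exact ((hσ.differentiable one_ne_zero _).hasDerivAt).comp θ h1
  have := intervalIntegral.integral_eq_sub_of_hasDerivAt h
    (Continuous.intervalIntegrable (by fun_prop) _ _)
  rw [intervalIntegral.integral_mul_const] at this
  simpa [derivAverage] using this

section Flow

variable {σ : ℝ → ℝ} {F : ℝ × ℝ → ℝ} {C : ℝ}

theorem flow_sub_flow (hσ : ContDiff ℝ 1 σ) (hF0 : ∀ x : ℝ, F (0, x) = x)
    (hFr : ∀ r x : ℝ, HasDerivAt (fun r' : ℝ => F (r', x)) (σ (F (r, x))) r) (r x y : ℝ) :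
    F (r, y) - F (r, x) =
      (y - x) * Real.exp (∫ u in (0:ℝ)..r, derivAverage σ (F (u, x)) (F (u, y))) := by
  have hcF : ∀ x, Continuous fun r : ℝ => F (r, x) := fun x =>
    continuous_iff_continuousAt.2 fun r => (hFr r x).continuousAt
  set q : ℝ → ℝ := fun u => derivAverage σ (F (u, x)) (F (u, y)) with hq
  have hqc : Continuous q :=
    (continuous_derivAverage (hσ.continuous_deriv le_rfl)).comp ((hcF x).prodMk (hcF y))
  have hP : ∀ r, HasDerivAt (fun r : ℝ => ∫ u in (0:ℝ)..r, q u) (q r) r := fun r =>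
    intervalIntegral.integral_hasDerivAt_right (hqc.intervalIntegrable _ _)
      (hqc.stronglyMeasurableAtFilter _ _) hqc.continuousAt
  have hE : ∀ r, HasDerivAt
      (fun r : ℝ => (F (r, y) - F (r, x)) * Real.exp (-∫ u in (0:ℝ)..r, q u)) 0 r := by
    intro r
    refine (((hFr r y).sub (hFr r x)).mul (hP r).neg.exp).congr_deriv ?_
    simp only [Pi.sub_apply]
    rw [← derivAverage_mul_sub hσ]
    simp only [hq]
    ring
  have hconst := is_const_of_deriv_eq_zero (fun r => (hE r).differentiableAt)
    (fun r => (hE r).deriv) r 0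
  simp only [hF0, intervalIntegral.integral_same, neg_zero, Real.exp_zero, mul_one] at hconst
  rw [← hconst, mul_assoc, ← Real.exp_add]
  simp

theorem abs_integral_derivAverage_le (hC : ∀ x, |deriv σ x| ≤ C) (f g : ℝ → ℝ) (r : ℝ) :
    |∫ u in (0:ℝ)..r, derivAverage σ (f u) (g u)| ≤ C * |r| := by
  simpa using intervalIntegral.norm_integral_le_of_norm_le_const (a := (0:ℝ)) (b := r) (C := C)
    (f := fun u => derivAverage σ (f u) (g u)) (fun u _ => abs_derivAverage_le hC _ _)

theorem abs_flow_sub_flow_le (hσ : ContDiff ℝ 1 σ) (hC : ∀ x, |deriv σ x| ≤ C)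
    (hF0 : ∀ x : ℝ, F (0, x) = x)
    (hFr : ∀ r x : ℝ, HasDerivAt (fun r' : ℝ => F (r', x)) (σ (F (r, x))) r) (r x y : ℝ) :
    |F (r, y) - F (r, x)| ≤ Real.exp (C * |r|) * |y - x| := by
  rw [flow_sub_flow hσ hF0 hFr, abs_mul, Real.abs_exp, mul_comm]
  gcongr
  exact (abs_le.1 (abs_integral_derivAverage_le hC _ _ r)).2

theorem abs_sub_le_abs_flow_sub_flow (hσ : ContDiff ℝ 1 σ) (hC : ∀ x, |deriv σ x| ≤ C)
    (hF0 : ∀ x : ℝ, F (0, x) = x)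
    (hFr : ∀ r x : ℝ, HasDerivAt (fun r' : ℝ => F (r', x)) (σ (F (r, x))) r) (r x y : ℝ) :
    |y - x| ≤ Real.exp (C * |r|) * |F (r, y) - F (r, x)| := by
  rw [flow_sub_flow hσ hF0 hFr, abs_mul, Real.abs_exp, mul_left_comm, ← Real.exp_add]
  apply le_mul_of_one_le_right (abs_nonneg _)
  rw [Real.one_le_exp_iff]
  linarith [(abs_le.1 (abs_integral_derivAverage_le hC
    (fun u => F (u, x)) (fun u => F (u, y)) r)).1]

theorem continuous_flow (hσ : ContDiff ℝ 1 σ) (hC : ∀ x, |deriv σ x| ≤ C)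
    (hF0 : ∀ x : ℝ, F (0, x) = x)
    (hFr : ∀ r x : ℝ, HasDerivAt (fun r' : ℝ => F (r', x)) (σ (F (r, x))) r) :
    Continuous F := by
  have hcF : ∀ x, Continuous fun r : ℝ => F (r, x) := fun x =>
    continuous_iff_continuousAt.2 fun r => (hFr r x).continuousAt
  rw [continuous_iff_continuousAt]
  rintro ⟨r₀, x₀⟩
  have hlim : Filter.Tendsto (fun p : ℝ × ℝ =>
      Real.exp (C * |p.1|) * |p.2 - x₀| + |F (p.1, x₀) - F (r₀, x₀)|) (nhds (r₀, x₀)) (nhds 0) := by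
    have h1 : Continuous fun p : ℝ × ℝ => F (p.1, x₀) := (hcF x₀).comp continuous_fst
    have : Continuous fun p : ℝ × ℝ =>
        Real.exp (C * |p.1|) * |p.2 - x₀| + |F (p.1, x₀) - F (r₀, x₀)| :=
      Continuous.add (by fun_prop) (h1.sub continuous_const).abs
    simpa using this.tendsto (r₀, x₀)
  rw [ContinuousAt, tendsto_iff_norm_sub_tendsto_zero]
  refine squeeze_zero (fun _ => norm_nonneg _) (fun p => ?_) hlim
  calc |F p - F (r₀, x₀)| ≤ |F (p.1, p.2) - F (p.1, x₀)| + |F (p.1, x₀) - F (r₀, x₀)| :=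
        abs_sub_le _ _ _
    _ ≤ _ := by gcongr; exact abs_flow_sub_flow_le hσ hC hF0 hFr _ _ _

theorem hasDerivAt_flow (hσ : ContDiff ℝ 1 σ) (hC : ∀ x, |deriv σ x| ≤ C)
    (hF0 : ∀ x : ℝ, F (0, x) = x)
    (hFr : ∀ r x : ℝ, HasDerivAt (fun r' : ℝ => F (r', x)) (σ (F (r, x))) r) (r x : ℝ) :
    HasDerivAt (fun x' : ℝ => F (r, x'))
      (Real.exp (∫ u in (0:ℝ)..r, deriv σ (F (u, x)))) x := by
  have hF := continuous_flow hσ hC hF0 hFr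
  rw [hasDerivAt_iff_tendsto_slope]
  have hcont : Continuous fun y =>
      Real.exp (∫ u in (0:ℝ)..r, derivAverage σ (F (u, x)) (F (u, y))) := by
    refine Real.continuous_exp.comp
      (intervalIntegral.continuous_parametric_intervalIntegral_of_continuous' ?_ _ _)
    exact (continuous_derivAverage (hσ.continuous_deriv le_rfl)).comp
      ((hF.comp (continuous_snd.prodMk continuous_const)).prodMk
        (hF.comp (continuous_snd.prodMk continuous_fst)))
  have h := (hcont.tendsto x).mono_left (nhdsWithin_le_nhds (s := {x}ᶜ))
  simp only [derivAverage_self] at h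
  refine h.congr' ?_
  filter_upwards [self_mem_nhdsWithin] with y hy
  have : y - x ≠ 0 := sub_ne_zero.2 hy
  rw [slope_def_field, flow_sub_flow hσ hF0 hFr]
  field_simp

/-- The derivative of the inverse flow map `H (r, ·)` at `F (r, x)`. -/
theorem hasDerivAt_inverse_flow (hσ : ContDiff ℝ 1 σ) (hC : ∀ x, |deriv σ x| ≤ C)
    (hF0 : ∀ x : ℝ, F (0, x) = x)
    (hFr : ∀ r x : ℝ, HasDerivAt (fun r' : ℝ => F (r', x)) (σ (F (r, x))) r)
    {h : ℝ → ℝ} {r : ℝ} (hl : Function.LeftInverse h (fun x : ℝ => F (r, x)))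
    (hr : Function.RightInverse h (fun x : ℝ => F (r, x))) (x : ℝ) :
    HasDerivAt h (Real.exp (-∫ u in (0:ℝ)..r, deriv σ (F (u, x)))) (F (r, x)) := by
  have hlip : LipschitzWith (Real.exp (C * |r|)).toNNReal h := by
    refine LipschitzWith.of_dist_le_mul fun y z => ?_
    rw [Real.coe_toNNReal _ (Real.exp_pos _).le, Real.dist_eq, Real.dist_eq]
    have := abs_sub_le_abs_flow_sub_flow hσ hC hF0 hFr r (h z) (h y)
    rwa [show F (r, h y) = y from hr y, show F (r, h z) = z from hr z] at this
  rw [Real.exp_neg]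
  refine HasDerivAt.of_local_left_inverse (f := fun x' : ℝ => F (r, x'))
    hlip.continuous.continuousAt ?_ (Real.exp_ne_zero _)
    (Filter.Eventually.of_forall fun y => hr y)
  rw [show h (F (r, x)) = x from hl x]
  exact hasDerivAt_flow hσ hC hF0 hFr r x

end Flow

theorem abs_exp_sub_exp_le {u v c : ℝ} (hu : u ≤ c) (hv : v ≤ c) :
    |Real.exp u - Real.exp v| ≤ Real.exp c * |u - v| :=
  Convex.norm_image_sub_le_of_norm_deriv_le (s := Set.Iic c) (f := Real.exp)
    (fun _ _ => Real.differentiableAt_exp)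
    (fun x hx => by simpa using hx) (convex_Iic c) hv hu

/-- Grönwall's inequality in integral form. -/
theorem le_mul_exp_of_le_add_integral {Δ : ℝ → ℝ} (hΔ : Continuous Δ) (hΔ0 : ∀ t, 0 ≤ Δ t)
    {T η K : ℝ} (hK : 0 < K)
    (h : ∀ t ∈ Set.Icc 0 T, Δ t ≤ η + K * ∫ s in (0:ℝ)..t, Δ s) :
    ∀ t ∈ Set.Icc 0 T, Δ t ≤ η * Real.exp (K * t) := by
  intro t ht
  have hd : ∀ r, HasDerivAt (fun r : ℝ => ∫ u in (0:ℝ)..r, Δ u) (Δ r) r := fun r =>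
    intervalIntegral.integral_hasDerivAt_right (hΔ.intervalIntegrable _ _)
      (hΔ.stronglyMeasurableAtFilter _ _) hΔ.continuousAt
  have hw := norm_le_gronwallBound_of_norm_deriv_right_le (a := 0) (b := T) (δ := 0) (K := K)
    (ε := η) (f := fun r : ℝ => ∫ u in (0:ℝ)..r, Δ u) (f' := Δ)
    (fun r _ => (hd r).continuousAt.continuousWithinAt) (fun r _ => (hd r).hasDerivWithinAt)
    (by simp) (fun r hr => by
      have h0 : 0 ≤ ∫ u in (0:ℝ)..r, Δ u :=
        intervalIntegral.integral_nonneg hr.1 fun u _ => hΔ0 u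
      rw [Real.norm_of_nonneg (hΔ0 r), Real.norm_of_nonneg h0, add_comm]
      exact h r ⟨hr.1, hr.2.le⟩) t ht
  simp only [gronwallBound_of_K_ne_0 hK.ne', sub_zero, zero_mul, zero_add] at hw
  have hw' := (le_abs_self _).trans hw
  calc Δ t ≤ η + K * ∫ s in (0:ℝ)..t, Δ s := h t ht
    _ ≤ η + K * (η / K * (Real.exp (K * t) - 1)) := by gcongr
    _ = η * Real.exp (K * t) := by field_simp; ring

/-- If `k s` has bounded primitive uniformly in `s`, the integral of `k s (s / ε)` over a short
interval is controlled by the oscillation of `k` in the slow variable. -/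
theorem abs_integral_fast_le {k : ℝ → ℝ → ℝ} (hk : Continuous (Function.uncurry k)) {M δ : ℝ}
    (hM : ∀ s r, 0 ≤ r → |∫ u in (0:ℝ)..r, k s u| ≤ M) {u v : ℝ} (hu : 0 ≤ u) (huv : u ≤ v)
    (hδ : ∀ s ∈ Set.Icc u v, ∀ t, |k s t - k u t| ≤ δ) {ε : ℝ} (hε : 0 < ε) :
    |∫ s in u..v, k s (s / ε)| ≤ δ * (v - u) + 2 * M * ε := by
  have hc1 : Continuous fun s => k s (s / ε) :=
    hk.comp (continuous_id.prodMk (continuous_id.div_const ε))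
  have hc2 : Continuous fun s => k u s := hk.comp (continuous_const.prodMk continuous_id)
  have hc3 : Continuous fun s => k u (s / ε) := hc2.comp (continuous_id.div_const ε)
  have hsplit : ∫ s in u..v, k s (s / ε) =
      (∫ s in u..v, (k s (s / ε) - k u (s / ε))) + ∫ s in u..v, k u (s / ε) := by
    rw [intervalIntegral.integral_sub (hc1.intervalIntegrable _ _) (hc3.intervalIntegrable _ _)]
    ring
  have h1 : |∫ s in u..v, (k s (s / ε) - k u (s / ε))| ≤ δ * (v - u) := by
    have := intervalIntegral.norm_integral_le_of_norm_le_const (a := u) (b := v) (C := δ)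
      (f := fun s => k s (s / ε) - k u (s / ε)) (fun s hs => by
        rw [Set.uIoc_of_le huv] at hs
        exact hδ s ⟨hs.1.le, hs.2⟩ _)
    rwa [abs_of_nonneg (sub_nonneg.2 huv)] at this
  have h2 : |∫ s in u..v, k u (s / ε)| ≤ 2 * M * ε := by
    rw [intervalIntegral.integral_comp_div (fun s => k u s) hε.ne', smul_eq_mul, abs_mul,
      abs_of_pos hε, ← intervalIntegral.integral_interval_sub_left
        (hc2.intervalIntegrable 0 (v / ε)) (hc2.intervalIntegrable 0 (u / ε)), mul_comm]
    gcongr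
    calc _ ≤ _ := abs_sub _ _
      _ ≤ M + M := 
        add_le_add (hM _ _ (div_nonneg (hu.trans huv) hε.le)) (hM _ _ (div_nonneg hu hε.le))
      _ = 2 * M := by ring
  rw [hsplit]
  exact (abs_add_le _ _).trans (add_le_add h1 h2)

/-- Averaging for integrals: fast oscillations with uniformly bounded primitives vanish in the
limit, uniformly in the upper endpoint. -/
theorem eventually_abs_integral_fast_le {k : ℝ → ℝ → ℝ} (hk : Continuous (Function.uncurry k))
    {M T : ℝ} (hT : 0 < T) (hM : ∀ s r, 0 ≤ r → |∫ u in (0:ℝ)..r, k s u| ≤ M)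
    (hosc : ∀ δ > 0, ∃ η > 0, ∀ s ∈ Set.Icc 0 T, ∀ s' ∈ Set.Icc 0 T, |s - s'| ≤ η →
      ∀ t, |k s t - k s' t| ≤ δ) {δ : ℝ} (hδ : 0 < δ) :
    ∀ᶠ ε in nhdsWithin 0 (Set.Ioi 0), ∀ t ∈ Set.Icc 0 T, |∫ s in (0:ℝ)..t, k s (s / ε)| ≤ δ := by
  obtain ⟨η, hη, hη'⟩ := hosc (δ / (2 * T)) (by positivity)
  have hind : ∀ n : ℕ, ∀ ε > 0, ∀ t ∈ Set.Icc 0 T, t ≤ n * η →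
      |∫ s in (0:ℝ)..t, k s (s / ε)| ≤ δ / (2 * T) * t + n * (2 * M * ε) := by
    intro n ε hε
    have hc1 : Continuous fun s => k s (s / ε) :=
      hk.comp (continuous_id.prodMk (continuous_id.div_const ε))
    have hM0 : 0 ≤ M := (abs_nonneg _).trans (hM 0 0 le_rfl)
    induction n with
    | zero =>
      intro t ht htn
      obtain rfl : t = 0 := le_antisymm (by simpa using htn) ht.1
      simp
    | succ n ih =>
      intro t ht htn
      push_cast at htn ⊢
      have hu0 : 0 ≤ max 0 (t - η) := le_max_left _ _
      have hut : max 0 (t - η) ≤ t := max_le ht.1 (by linarith)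
      have hηu : t - η ≤ max 0 (t - η) := le_max_right _ _
      have h1 := ih (max 0 (t - η)) ⟨hu0, hut.trans ht.2⟩
        (max_le (by positivity) (by linarith))
      have h2 := abs_integral_fast_le hk hM hu0 hut (δ := δ / (2 * T)) (fun s hs x =>
        hη' s ⟨hu0.trans hs.1, hs.2.trans ht.2⟩ _ ⟨hu0, hut.trans ht.2⟩
          (abs_le.2 ⟨by linarith [hs.1], by linarith [hs.2]⟩) x) hε
      rw [← intervalIntegral.integral_add_adjacent_intervals
        (hc1.intervalIntegrable 0 (max 0 (t - η))) (hc1.intervalIntegrable _ t)]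
      refine (abs_add_le _ _).trans ((add_le_add h1 h2).trans (le_of_eq ?_))
      ring
  obtain ⟨n, hn⟩ := exists_nat_gt (T / η)
  have hlim : Filter.Tendsto (fun ε : ℝ => n * (2 * M * ε)) (nhdsWithin 0 (Set.Ioi 0)) (nhds 0) := by
    have : Continuous fun ε : ℝ => n * (2 * M * ε) := by fun_prop
    simpa using (this.tendsto 0).mono_left nhdsWithin_le_nhds
  filter_upwards [hlim.eventually_le_const (half_pos hδ), self_mem_nhdsWithin] with ε h1 hε t ht
  have htn : t ≤ n * η := ht.2.trans ((div_lt_iff₀ hη).1 hn).le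
  have h3 : δ / (2 * T) * t ≤ δ / 2 := by
    calc _ ≤ δ / (2 * T) * T := by gcongr; exact ht.2
      _ = δ / 2 := by field_simp
  linarith [hind n ε hε t ht htn]

/-- Time averages inherit Lipschitz bounds. -/
theorem abs_sub_le_of_tendsto_average {f g : ℝ → ℝ} (hf : Continuous f) (hg : Continuous g)
    {a c K : ℝ} (hK : ∀ t, |f t - g t| ≤ K)
    (ha : Filter.Tendsto (fun t : ℝ => (1 / t) * ∫ s in (0:ℝ)..t, f s) Filter.atTop (nhds a))
    (hc : Filter.Tendsto (fun t : ℝ => (1 / t) * ∫ s in (0:ℝ)..t, g s) Filter.atTop (nhds c)) :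
    |a - c| ≤ K := by
  refine le_of_tendsto (ha.sub hc).abs ?_
  filter_upwards [Filter.eventually_gt_atTop 0] with t ht
  have := intervalIntegral.norm_integral_le_of_norm_le_const (a := 0) (b := t) (C := K)
    (f := fun s => f s - g s) (fun s _ => hK s)
  rw [intervalIntegral.integral_sub (hf.intervalIntegrable _ _) (hg.intervalIntegrable _ _),
    sub_zero, Real.norm_eq_abs, abs_of_pos ht] at this
  rw [← mul_sub, abs_mul, abs_of_pos (by positivity), one_div, inv_mul_le_iff₀ ht, mul_comm]
  exact this

/-- The derivative `(∂H/∂x) (r, F (r, y))` of the inverse flow, as a function of `r` and `y`. -/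
noncomputable def inverseFlowDeriv (σ : ℝ → ℝ) (F : ℝ × ℝ → ℝ) (r y : ℝ) : ℝ :=
  Real.exp (-∫ u in (0:ℝ)..r, deriv σ (F (u, y)))

section InverseFlowDeriv

variable {σ : ℝ → ℝ} {F : ℝ × ℝ → ℝ} {C : ℝ}

theorem continuous_inverseFlowDeriv (hσ : Continuous (deriv σ)) (hF : Continuous F) :
    Continuous fun p : ℝ × ℝ => inverseFlowDeriv σ F p.1 p.2 := by
  refine Real.continuous_exp.comp (Continuous.neg ?_)
  apply intervalIntegral.continuous_parametric_intervalIntegral_of_continuous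
    (f := fun (p : ℝ × ℝ) u => deriv σ (F (u, p.2))) _ continuous_fst
  exact hσ.comp (hF.comp (continuous_snd.prodMk (continuous_snd.comp continuous_fst)))

theorem neg_integral_deriv_flow_le (hC : ∀ x, |deriv σ x| ≤ C) {K r : ℝ} (hr : |r| ≤ K) (y : ℝ) :
    -∫ u in (0:ℝ)..r, deriv σ (F (u, y)) ≤ C * K := by
  have h := intervalIntegral.norm_integral_le_of_norm_le_const (a := (0:ℝ)) (b := r) (C := C)
    (f := fun u => deriv σ (F (u, y))) (fun u _ => hC _)
  rw [sub_zero] at h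
  exact (neg_le_abs _).trans
    (h.trans (mul_le_mul_of_nonneg_left hr ((abs_nonneg _).trans (hC 0))))

theorem abs_inverseFlowDeriv_le (hC : ∀ x, |deriv σ x| ≤ C) {K r : ℝ} (hr : |r| ≤ K) (y : ℝ) :
    |inverseFlowDeriv σ F r y| ≤ Real.exp (C * K) := by
  rw [inverseFlowDeriv, Real.abs_exp]
  exact Real.exp_le_exp.2 (neg_integral_deriv_flow_le hC hr y)

theorem abs_inverseFlowDeriv_sub_le (hσ : ContDiff ℝ 2 σ) (hC : ∀ x, |deriv σ x| ≤ C)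
    {C₂ : ℝ} (hC₂ : ∀ x, |deriv (deriv σ) x| ≤ C₂)
    (hF0 : ∀ x : ℝ, F (0, x) = x)
    (hFr : ∀ r x : ℝ, HasDerivAt (fun r' : ℝ => F (r', x)) (σ (F (r, x))) r)
    {K r : ℝ} (hr : |r| ≤ K) (x y : ℝ) :
    |inverseFlowDeriv σ F r y - inverseFlowDeriv σ F r x| ≤
      Real.exp (C * K) * (C₂ * Real.exp (C * K) * K) * |y - x| := by
  have hσ1 : ContDiff ℝ 1 σ := hσ.of_le one_le_two
  have hd : ContDiff ℝ 1 (deriv σ) := ContDiff.deriv' hσ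
  have hF := continuous_flow hσ1 hC hF0 hFr
  have hC0 : 0 ≤ C := (abs_nonneg _).trans (hC 0)
  have hC20 : 0 ≤ C₂ := (abs_nonneg _).trans (hC₂ 0)
  have hc : ∀ z, Continuous fun u => deriv σ (F (u, z)) := fun z =>
    hd.continuous.comp (hF.comp (continuous_id.prodMk continuous_const))
  have hlip : ∀ p q, |deriv σ p - deriv σ q| ≤ C₂ * |p - q| := fun p q =>
    Convex.norm_image_sub_le_of_norm_deriv_le (s := Set.univ) (f := deriv σ)
      (fun z _ => hd.differentiable one_ne_zero z) (fun z _ => hC₂ z) convex_univ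
      (Set.mem_univ _) (Set.mem_univ _)
  have hint : |(∫ u in (0:ℝ)..r, deriv σ (F (u, x))) - ∫ u in (0:ℝ)..r, deriv σ (F (u, y))| ≤
      C₂ * (Real.exp (C * K) * |y - x|) * |r| := by
    rw [← intervalIntegral.integral_sub ((hc x).intervalIntegrable _ _)
      ((hc y).intervalIntegrable _ _)]
    have := intervalIntegral.norm_integral_le_of_norm_le_const (a := (0:ℝ)) (b := r)
      (C := C₂ * (Real.exp (C * K) * |y - x|))
      (f := fun u => deriv σ (F (u, x)) - deriv σ (F (u, y))) (fun u hu => by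
        refine (hlip _ _).trans (mul_le_mul_of_nonneg_left ?_ hC20)
        rw [abs_sub_comm]
        refine (abs_flow_sub_flow_le hσ1 hC hF0 hFr u x y).trans ?_
        have hur : |u| ≤ K := by
          have := Set.abs_sub_left_of_mem_uIcc (Set.uIoc_subset_uIcc hu)
          rw [sub_zero, sub_zero] at this
          exact this.trans hr
        gcongr)
    simpa using this
  refine (abs_exp_sub_exp_le (neg_integral_deriv_flow_le hC hr y)
    (neg_integral_deriv_flow_le hC hr x)).trans ?_
  rw [mul_assoc (Real.exp (C * K)), neg_sub_neg]
  gcongr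
  calc _ ≤ C₂ * (Real.exp (C * K) * |y - x|) * |r| := hint
    _ ≤ C₂ * (Real.exp (C * K) * |y - x|) * K := by gcongr
    _ = _ := by ring

end InverseFlowDeriv

theorem abs_mul_sub_mul_le {a a' c c' A B p q : ℝ} (ha' : |a'| ≤ A) (hc : |c| ≤ B)
    (hp : |a - a'| ≤ p) (hq : |c - c'| ≤ q) : |a * c - a' * c'| ≤ p * B + A * q := by
  have h1 : |(a - a') * c| ≤ p * B := by
    rw [abs_mul]
    exact mul_le_mul hp hc (abs_nonneg _) ((abs_nonneg _).trans hp)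
  have h2 : |a' * (c - c')| ≤ A * q := by
    rw [abs_mul]
    exact mul_le_mul ha' hq (abs_nonneg _) ((abs_nonneg _).trans ha')
  calc |a * c - a' * c'| = |(a - a') * c + a' * (c - c')| := by ring_nf
    _ ≤ _ := (abs_add_le _ _).trans (add_le_add h1 h2)

theorem ContinuousOn.exists_continuous_bounded_eqOn_Icc {f : ℝ → ℝ} {T : ℝ} (hT : 0 ≤ T)
    (hf : ContinuousOn f (Set.Icc 0 T)) :
    ∃ g : ℝ → ℝ, Continuous g ∧ Set.EqOn g f (Set.Icc 0 T) ∧ ∃ K, ∀ t, |g t| ≤ K := by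
  obtain ⟨K, hK⟩ := isCompact_Icc.exists_bound_of_continuousOn hf
  exact ⟨Set.IccExtend hT ((Set.Icc 0 T).domRestrict f), hf.domRestrict.Icc_extend',
    fun t ht => Set.IccExtend_of_mem hT _ ht, K, fun t => hK _ (Set.projIcc 0 T hT t).2⟩

/-- A solution of the transformed equation agrees on `[0, T]` with a continuous function on `ℝ`
solving the equation in which the derivative of the inverse flow is explicit. -/
theorem SolvesAveragingODE.exists_continuous_extension {σ : ℝ → ℝ} (hσ : ContDiff ℝ 1 σ) {C : ℝ}
    (hC : ∀ x, |deriv σ x| ≤ C) {F H : ℝ × ℝ → ℝ} (hF0 : ∀ x : ℝ, F (0, x) = x)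
    (hFr : ∀ r x : ℝ, HasDerivAt (fun r' : ℝ => F (r', x)) (σ (F (r, x))) r)
    (hH : ∀ r : ℝ, Function.LeftInverse (fun y : ℝ => H (r, y)) (fun x : ℝ => F (r, x)) ∧
      Function.RightInverse (fun y : ℝ => H (r, y)) (fun x : ℝ => F (r, x)))
    {b : ℝ × ℝ → ℝ} {m m' : ℝ → ℝ} {T x₀ ε : ℝ} (hT : 0 ≤ T)
    (hm : Set.EqOn m' m (Set.Icc 0 T)) {Y : ℝ → ℝ} (hY : SolvesAveragingODE F H b m T x₀ ε Y) :
    ∃ Z : ℝ → ℝ, Continuous Z ∧ Set.EqOn Z Y (Set.Icc 0 T) ∧ (∃ K, ∀ t, |Z t| ≤ K) ∧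
      ∀ t ∈ Set.Icc 0 T, Z t = H (0, x₀) + ∫ s in (0:ℝ)..t,
        inverseFlowDeriv σ F (m' s) (Z s) * b (F (m' s, Z s), s / ε) := by
  obtain ⟨Z, hZ, hZY, hK⟩ := hY.1.exists_continuous_bounded_eqOn_Icc hT
  refine ⟨Z, hZ, hZY, hK, fun t ht => ?_⟩
  rw [hZY ht, hY.2 t ht]
  congr 1
  refine intervalIntegral.integral_congr fun s hs => ?_
  rw [Set.uIcc_of_le ht.1] at hs
  have hs' : s ∈ Set.Icc 0 T := ⟨hs.1, hs.2.trans ht.2⟩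
  simp only [hm hs', hZY hs']
  rw [(hasDerivAt_inverse_flow hσ hC hF0 hFr (hH (m s)).1 (hH (m s)).2 (Y s)).deriv,
    inverseFlowDeriv]

/-- The slow-fast integrand along a fixed continuous path averages out. -/
theorem eventually_abs_integral_centered_le {b : ℝ × ℝ → ℝ} (hbc : Continuous b) {bbar : ℝ → ℝ}
    (hbbar : Continuous bbar) {B : ℝ} (hB : ∀ p, |b p| ≤ B) (hBbar : ∀ y, |bbar y| ≤ B)
    {Λ c T : ℝ} (hΛ0 : 0 ≤ Λ) (hT : 0 < T)
    (hΛ : ∀ x y t : ℝ, |x| ≤ c → |y| ≤ c → |b (x, t) - b (y, t)| ≤ Λ * |x - y|)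
    (hΛbar : ∀ x y : ℝ, |x| ≤ c → |y| ≤ c → |bbar x - bbar y| ≤ Λ * |x - y|)
    {M : ℝ} (hG : ∀ y : ℝ, ∀ r : ℝ, 0 ≤ r → |∫ s in (0:ℝ)..r, (b (y, s) - bbar y)| ≤ M)
    {φ ψ : ℝ → ℝ} (hφ : Continuous φ) (hψ : Continuous ψ) {A : ℝ} (hφc : ∀ t, |φ t| ≤ c)
    (hψA : ∀ t, |ψ t| ≤ A) {δ : ℝ} (hδ : 0 < δ) :
    ∀ᶠ ε in nhdsWithin 0 (Set.Ioi 0), ∀ t ∈ Set.Icc 0 T,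
      |∫ s in (0:ℝ)..t, ψ s * (b (φ s, s / ε) - bbar (φ s))| ≤ δ := by
  have hA0 : 0 ≤ A := (abs_nonneg _).trans (hψA 0)
  have hB0 : 0 ≤ B := (abs_nonneg _).trans (hB 0)
  refine eventually_abs_integral_fast_le (k := fun s t => ψ s * (b (φ s, t) - bbar (φ s)))
    (M := A * M) ?_ hT ?_ ?_ hδ
  · unfold Function.uncurry
    fun_prop
  · intro s r hr
    rw [intervalIntegral.integral_const_mul, abs_mul]
    exact mul_le_mul (hψA s) (hG _ r hr) (abs_nonneg _) hA0
  · intro δ hδ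
    set N : ℝ := B + B + A * (Λ + Λ) + 1 with hN
    have hN0 : 0 < N := by positivity
    have huc := Metric.uniformContinuousOn_iff_le.1
      (isCompact_Icc.uniformContinuousOn_of_continuous (s := Set.Icc 0 T)
        (hψ.prodMk hφ).continuousOn) (δ / N) (by positivity)
    obtain ⟨η, hη, h⟩ := huc
    refine ⟨η, hη, fun s hs s' hs' hss t => ?_⟩
    have hd := h s hs s' hs' hss
    rw [Prod.dist_eq, max_le_iff, Real.dist_eq, Real.dist_eq] at hd
    refine (abs_mul_sub_mul_le (B := B + B) (q := (Λ + Λ) * (δ / N)) (hψA s') ?_ hd.1 ?_).trans ?_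
    · exact (abs_sub _ _).trans (add_le_add (hB _) (hBbar _))
    · have h1 := hΛ _ _ t (hφc s) (hφc s')
      have h2 := hΛbar _ _ (hφc s) (hφc s')
      calc _ = |(b (φ s, t) - b (φ s', t)) - (bbar (φ s) - bbar (φ s'))| := by ring_nf
        _ ≤ _ := abs_sub _ _
        _ ≤ Λ * |φ s - φ s'| + Λ * |φ s - φ s'| := add_le_add h1 h2
        _ = (Λ + Λ) * |φ s - φ s'| := by ring
        _ ≤ _ := by gcongr; exact hd.2
    · calc _ = (B + B + A * (Λ + Λ)) * (δ / N) := by ring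
        _ ≤ N * (δ / N) := by gcongr; linarith
        _ = δ := by field_simp

/-- **pathwise averaging principle.**
`sup_{t ∈ [0,T]} |X^ε t − X̄ t| → 0` as `ε → 0⁺`, where `X^ε t = F (m t, Y^ε t)` with
`Y^ε` the solution of the transformed equation with drift `b (·, s/ε)`, and
`X̄ t = F (m t, Ȳ t)` with `Ȳ` the solution of the averaged equation. -/
theorem averaging_principle_pathwise
    (σ : ℝ → ℝ) (hσ : ContDiff ℝ 2 σ)
    (C₁ : ℝ) (hC₁ : ∀ x, |deriv σ x| ≤ C₁)
    (C₂ : ℝ) (hC₂ : ∀ x, |deriv (deriv σ) x| ≤ C₂)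
    (F H : ℝ × ℝ → ℝ)
    (hF0 : ∀ x : ℝ, F (0, x) = x)
    (hFr : ∀ r x : ℝ, HasDerivAt (fun r' : ℝ => F (r', x)) (σ (F (r, x))) r)
    (hH : ∀ r : ℝ, Function.LeftInverse (fun y : ℝ => H (r, y)) (fun x : ℝ => F (r, x)) ∧
      Function.RightInverse (fun y : ℝ => H (r, y)) (fun x : ℝ => F (r, x)))
    (b : ℝ × ℝ → ℝ) (hbc : Continuous b)
    (B : ℝ) (hB : ∀ p, |b p| ≤ B)
    (L : ℝ → ℝ)
    (hbL : ∀ c : ℝ, 0 < c → ∀ x y t : ℝ, |x| ≤ c → |y| ≤ c →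
      |b (x, t) - b (y, t)| ≤ L c * |x - y|)
    (T : ℝ) (hT : 0 < T)
    (m : ℝ → ℝ) (hm : ContinuousOn m (Set.Icc 0 T)) (hm0 : m 0 = 0)
    (x₀ : ℝ)
    (bbar : ℝ → ℝ)
    (hbar : ∀ y : ℝ, Filter.Tendsto (fun t : ℝ => (1 / t) * ∫ s in (0:ℝ)..t, b (y, s))
      Filter.atTop (nhds (bbar y)))
    (M : ℝ)
    (hG : ∀ y : ℝ, ∀ r : ℝ, 0 ≤ r → |∫ s in (0:ℝ)..r, (b (y, s) - bbar y)| ≤ M)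
    (Y : ℝ → ℝ → ℝ) (hY : ∀ ε : ℝ, 0 < ε → SolvesAveragingODE F H b m T x₀ ε (Y ε))
    (Ybar : ℝ → ℝ) (hYbar : SolvesAveragingODE F H (fun p : ℝ × ℝ => bbar p.1) m T x₀ 1 Ybar) :
    Filter.Tendsto
      (fun ε : ℝ => ⨆ t : Set.Icc (0:ℝ) T, |F (m t, Y ε t) - F (m t, Ybar t)|)
      (nhdsWithin 0 (Set.Ioi 0)) (nhds 0) := by
  have hσ1 : ContDiff ℝ 1 σ := hσ.of_le one_le_two
  have hF := continuous_flow hσ1 hC₁ hF0 hFr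
  have hC0 : 0 ≤ C₁ := (abs_nonneg _).trans (hC₁ 0)
  have hC20 : 0 ≤ C₂ := (abs_nonneg _).trans (hC₂ 0)
  have hB0 : 0 ≤ B := (abs_nonneg _).trans (hB 0)
  have hbx : ∀ x, Continuous fun t => b (x, t) := fun x =>
    hbc.comp (continuous_const.prodMk continuous_id)
  have hBbar : ∀ y, |bbar y| ≤ B := fun y => by
    simpa using abs_sub_le_of_tendsto_average (g := fun _ => 0) (c := 0) (K := B) (hbx y)
      continuous_const (fun t => by simpa using hB (y, t)) (hbar y) (by simp)
  have hL : ∀ c : ℝ, 0 < c → ∀ x y t : ℝ, |x| ≤ c → |y| ≤ c →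
      |b (x, t) - b (y, t)| ≤ |L c| * |x - y| := fun c hc x y t hx hy =>
    (hbL c hc x y t hx hy).trans (by gcongr; exact le_abs_self _)
  have hLbar : ∀ c : ℝ, 0 < c → ∀ x y : ℝ, |x| ≤ c → |y| ≤ c →
      |bbar x - bbar y| ≤ |L c| * |x - y| := fun c hc x y hx hy =>
    abs_sub_le_of_tendsto_average (hbx x) (hbx y) (fun t => hL c hc x y t hx hy)
      (hbar x) (hbar y)
  have hbbar : Continuous bbar := by
    refine continuous_iff_continuousAt.2 fun x => ?_
    have hlip : LipschitzOnWith (Real.toNNReal |L (|x| + 1)|) bbar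
        (Set.Icc (-(|x| + 1)) (|x| + 1)) :=
      LipschitzOnWith.of_dist_le_mul fun y hy z hz => by
        rw [Real.coe_toNNReal _ (abs_nonneg _), Real.dist_eq, Real.dist_eq]
        exact hLbar _ (by positivity) y z (abs_le.2 hy) (abs_le.2 hz)
    exact hlip.continuousOn.continuousAt
      (Icc_mem_nhds (by linarith [neg_abs_le x]) (by linarith [le_abs_self x]))
  obtain ⟨m', hm'c, hm'm, K, hK⟩ := hm.exists_continuous_bounded_eqOn_Icc hT.le
  obtain ⟨Zb, hZbc, hZbY, ⟨Kb, hKb⟩, hZb⟩ :=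
    hYbar.exists_continuous_extension hσ1 hC₁ hF0 hFr hH hT.le hm'm
  have hK0 : 0 ≤ K := (abs_nonneg _).trans (hK 0)
  set A : ℝ := Real.exp (C₁ * K) with hA
  set R : ℝ := max (|H (0, x₀)| + A * B * T) Kb with hR
  obtain ⟨c, hc0, hc⟩ : ∃ c > 0, ∀ r y, |r| ≤ K → |y| ≤ R → |F (r, y)| ≤ c := by
    obtain ⟨c, hc⟩ := ((isCompact_Icc (a := -K) (b := K)).prod
      (isCompact_Icc (a := -R) (b := R))).exists_bound_of_continuousOn hF.continuousOn
    exact ⟨max c 1, by positivity, fun r y hr hy =>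
      (hc (r, y) ⟨abs_le.1 hr, abs_le.1 hy⟩).trans (le_max_left _ _)⟩
  have hg : Continuous fun p : ℝ × ℝ => inverseFlowDeriv σ F p.1 p.2 :=
    continuous_inverseFlowDeriv (hσ1.continuous_deriv le_rfl) hF
  have hcentered := fun δ (hδ : (0:ℝ) < δ) => eventually_abs_integral_centered_le hbc hbbar hB
    hBbar (abs_nonneg (L c)) hT (hL c hc0) (hLbar c hc0) hG (hF.comp (hm'c.prodMk hZbc))
    (hg.comp (hm'c.prodMk hZbc))
    (fun t => hc _ _ (hK t) ((hKb t).trans (le_max_right _ _)))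
    (fun t => abs_inverseFlowDeriv_le (F := F) hC₁ (hK t) _) hδ
  simp only [Function.comp_apply] at hcentered
  set Λ : ℝ := A * (C₂ * A * K) * B + A * (|L c| * A) + 1 with hΛ
  have hΛ0 : 0 < Λ := by positivity
  have hlip : ∀ s x y t, |x| ≤ R → |y| ≤ R →
      |inverseFlowDeriv σ F (m' s) x * b (F (m' s, x), t) -
        inverseFlowDeriv σ F (m' s) y * b (F (m' s, y), t)| ≤ Λ * |x - y| := by
    intro s x y t hx hy
    have hFxy : |F (m' s, x) - F (m' s, y)| ≤ A * |x - y| :=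
      (abs_flow_sub_flow_le hσ1 hC₁ hF0 hFr _ _ _).trans (by rw [hA]; gcongr; exact hK s)
    refine (abs_mul_sub_mul_le (abs_inverseFlowDeriv_le hC₁ (hK s) y) (hB _)
      (abs_inverseFlowDeriv_sub_le hσ hC₁ hC₂ hF0 hFr (hK s) y x)
      ((hL c hc0 _ _ t (hc _ _ (hK s) hx) (hc _ _ (hK s) hy)).trans
        (mul_le_mul_of_nonneg_left hFxy (abs_nonneg _)))).trans ?_
    rw [hΛ]
    nlinarith [abs_nonneg (x - y)]
  rw [Metric.tendsto_nhds]
  intro δ hδ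
  filter_upwards [hcentered (δ / 2 / (A * Real.exp (Λ * T))) (by positivity),
    self_mem_nhdsWithin] with ε hε hε0
  obtain ⟨Z, hZc, hZY, -, hZ⟩ :=
    (hY ε hε0).exists_continuous_extension hσ1 hC₁ hF0 hFr hH hT.le hm'm
  have hdrift : ∀ {X : ℝ → ℝ}, Continuous X → Continuous fun s =>
      inverseFlowDeriv σ F (m' s) (X s) * b (F (m' s, X s), s / ε) := fun hX =>
    (hg.comp (hm'c.prodMk hX)).mul
      (hbc.comp ((hF.comp (hm'c.prodMk hX)).prodMk (continuous_id.div_const ε)))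
  have hdriftbar : Continuous fun s =>
      inverseFlowDeriv σ F (m' s) (Zb s) * bbar (F (m' s, Zb s)) :=
    (hg.comp (hm'c.prodMk hZbc)).mul (hbbar.comp (hF.comp (hm'c.prodMk hZbc)))
  have hZR : ∀ t ∈ Set.Icc 0 T, |Z t| ≤ R := by
    intro t ht
    have := intervalIntegral.norm_integral_le_of_norm_le_const (a := 0) (b := t) (C := A * B)
      (f := fun s => inverseFlowDeriv σ F (m' s) (Z s) * b (F (m' s, Z s), s / ε))
      (fun s _ => by
        rw [norm_mul]
        exact mul_le_mul (abs_inverseFlowDeriv_le hC₁ (hK s) _) (hB _) (norm_nonneg _)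
          (Real.exp_pos _).le)
    rw [sub_zero, abs_of_nonneg ht.1] at this
    rw [hZ t ht]
    refine (abs_add_le _ _).trans (le_trans ?_ (le_max_left _ _))
    gcongr
    exact this.trans (by gcongr; exact ht.2)
  have hgronwall := le_mul_exp_of_le_add_integral (Δ := fun t => |Z t - Zb t|)
    (hZc.sub hZbc).abs (fun _ => abs_nonneg _) hΛ0
    (η := δ / 2 / (A * Real.exp (Λ * T))) (T := T) (fun t ht => by
      have hsplit : Z t - Zb t =
          (∫ s in (0:ℝ)..t, inverseFlowDeriv σ F (m' s) (Zb s) *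
            (b (F (m' s, Zb s), s / ε) - bbar (F (m' s, Zb s)))) +
          ∫ s in (0:ℝ)..t, (inverseFlowDeriv σ F (m' s) (Z s) * b (F (m' s, Z s), s / ε) -
            inverseFlowDeriv σ F (m' s) (Zb s) * b (F (m' s, Zb s), s / ε)) := by
        simp only [mul_sub]
        rw [intervalIntegral.integral_sub ((hdrift hZc).intervalIntegrable _ _)
            ((hdrift hZbc).intervalIntegrable _ _),
          intervalIntegral.integral_sub ((hdrift hZbc).intervalIntegrable _ _)
            (hdriftbar.intervalIntegrable _ _), hZ t ht, hZb t ht]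
        ring
      rw [hsplit, ← intervalIntegral.integral_const_mul]
      refine (abs_add_le _ _).trans (add_le_add (hε t ht) ?_)
      rw [← Real.norm_eq_abs]
      refine intervalIntegral.norm_integral_le_of_norm_le (E := ℝ) (μ := MeasureTheory.volume)
        (g := fun s => Λ * |Z s - Zb s|) ht.1 (Filter.Eventually.of_forall fun s hs => ?_)
        ((continuous_const.mul (hZc.sub hZbc).abs).intervalIntegrable _ _)
      exact hlip s _ _ _ (hZR s ⟨hs.1.le, hs.2.trans ht.2⟩)
        ((hKb s).trans (le_max_right _ _)))
  have hfin : ∀ t : Set.Icc (0:ℝ) T, |F (m t, Y ε t) - F (m t, Ybar t)| ≤ δ / 2 := by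
    rintro ⟨t, ht⟩
    change |F (m t, Y ε t) - F (m t, Ybar t)| ≤ δ / 2
    rw [← hm'm ht, ← hZY ht, ← hZbY ht]
    calc _ ≤ Real.exp (C₁ * |m' t|) * |Z t - Zb t| :=
          abs_flow_sub_flow_le hσ1 hC₁ hF0 hFr _ _ _
      _ ≤ A * (δ / 2 / (A * Real.exp (Λ * T)) * Real.exp (Λ * T)) := by
          rw [hA]
          gcongr
          · exact hK t
          · refine (hgronwall t ht).trans ?_
            gcongr
            exact ht.2
      _ = δ / 2 := by
          have hA0 : A ≠ 0 := Real.exp_ne_zero _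
          field_simp
  rw [dist_zero_right, Real.norm_of_nonneg (Real.iSup_nonneg fun _ => abs_nonneg _)]
  exact (Real.iSup_le hfin (half_pos hδ).le).trans_lt (half_lt_self hδ)
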